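/- Let C be a complete connected bounded median space of rank n and let h be a halfspace of C with nonempty complement. Let ε > 0 be such that there do not exist two disjoint halfspaces of depth greater than ε both contained in h. Then for every a ∈ h with d(a, ĥ) ≥ depth_C(h) − ε, the convex hull Conv({a} ∪ ĥ) is at Hausdorff distance at most (n(n+1)+1)·ε from h. -/

import Mathlib

/-- The interval `[a,b]` in a metric space: points `x` with `d(a,x) + d(x,b) = d(a,b)`. -/
def mInterval {X : Type*} [MetricSpace X] (a b : X) : Set X :=
  {x : X | dist a x + dist x b = dist a b}

/-- A median space: every triple of points has a unique median point. -/
def IsMedianSpace (X : Type*) [MetricSpace X] : Prop :=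
  ∀ a b c : X, ∃! m : X,
    m ∈ mInterval a b ∩ mInterval b c ∩ mInterval a c

/-- A subset is (median) convex if it contains the interval between any two of its points. -/
def MConvex {X : Type*} [MetricSpace X] (C : Set X) : Prop :=
  ∀ a ∈ C, ∀ b ∈ C, mInterval a b ⊆ C

/-- A halfspace: a convex subset with convex complement. -/
def IsHalfspace {X : Type*} [MetricSpace X] (h : Set X) : Prop :=
  MConvex h ∧ MConvex hᶜ

/-- Two subsets are transverse if the four pairwise intersections of them and
their complements are all nonempty. -/
def TransverseSets {X : Type*} (h₁ h₂ : Set X) : Prop :=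
  (h₁ ∩ h₂).Nonempty ∧ (h₁ᶜ ∩ h₂).Nonempty ∧ (h₁ ∩ h₂ᶜ).Nonempty ∧ (h₁ᶜ ∩ h₂ᶜ).Nonempty

/-- `X` has rank `n`: there are `n` pairwise transverse halfspaces but not `n+1`. -/
def HasMedianRank (X : Type*) [MetricSpace X] (n : ℕ) : Prop :=
  (∃ h : Fin n → Set X, (∀ i, IsHalfspace (h i)) ∧
    ∀ i j, i ≠ j → TransverseSets (h i) (h j)) ∧
  ¬ ∃ h : Fin (n + 1) → Set X, (∀ i, IsHalfspace (h i)) ∧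
    ∀ i j, i ≠ j → TransverseSets (h i) (h j)

/-- Median convex hull: intersection of all convex subsets containing `A`. -/
def mConvexHull {X : Type*} [MetricSpace X] (A : Set X) : Set X :=
  ⋂₀ {C : Set X | MConvex C ∧ A ⊆ C}

/-- The hyperplane bounding a halfspace `h`. -/
def mHyperplane {X : Type*} [MetricSpace X] (h : Set X) : Set X :=
  closure h ∩ closure hᶜ

/-- Depth of the halfspace `h` in the subset `A`:
`sup { d(x, ĥ) | x ∈ h ∩ A }`. -/
noncomputable def mDepth {X : Type*} [MetricSpace X] (A h : Set X) : ℝ :=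
  sSup ((fun x => Metric.infDist x (mHyperplane h)) '' (h ∩ A))

/-- `π` is the nearest-point projection onto `C`. -/
def IsNearestPointProj {X : Type*} [MetricSpace X] (C : Set X) (π : X → X) : Prop :=
  ∀ x : X, π x ∈ C ∧ dist x (π x) = Metric.infDist x C

/-- The halfspace `h` separates the points `x` and `y`. -/
def SeparatesPts {X : Type*} (h : Set X) (x y : X) : Prop :=
  (x ∈ h ∧ y ∈ hᶜ) ∨ (y ∈ h ∧ x ∈ hᶜ)

section Helpers

variable {X : Type*} [MetricSpace X]

theorem mi_def {a b x : X} : x ∈ mInterval a b ↔ dist a x + dist x b = dist a b := Iff.rfl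

theorem mi_symm {a b x : X} (hx : x ∈ mInterval a b) : x ∈ mInterval b a := by
  rw [mi_def] at *
  rw [dist_comm b x, dist_comm x a, dist_comm b a]; linarith

theorem mi_left (a b : X) : a ∈ mInterval a b := by simp [mi_def]

theorem mi_right (a b : X) : b ∈ mInterval a b := by simp [mi_def]

/-- If `x ∈ [a,b]` and `y ∈ [a,x]` then `y ∈ [a,b]`. -/
theorem mi_trans {a b x y : X} (hx : x ∈ mInterval a b) (hy : y ∈ mInterval a x) :
    y ∈ mInterval a b := by
  rw [mi_def] at *
  have h1 := dist_triangle y x b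
  have h2 := dist_triangle a y b
  linarith

/-- If `x ∈ [a,b]` and `y ∈ [a,x]` then `x ∈ [y,b]`. -/
theorem mi_trans' {a b x y : X} (hx : x ∈ mInterval a b) (hy : y ∈ mInterval a x) :
    x ∈ mInterval y b := by
  rw [mi_def] at *
  have h1 := dist_triangle y x b
  have h2 := dist_triangle a y b
  linarith

/-- The median. -/
noncomputable def med (hm : IsMedianSpace X) (a b c : X) : X := (hm a b c).choose

variable (hm : IsMedianSpace X)

theorem med_ab (a b c : X) : med hm a b c ∈ mInterval a b := (hm a b c).choose_spec.1.1.1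

theorem med_bc (a b c : X) : med hm a b c ∈ mInterval b c := (hm a b c).choose_spec.1.1.2

theorem med_ac (a b c : X) : med hm a b c ∈ mInterval a c := (hm a b c).choose_spec.1.2

theorem med_eq {a b c x : X} (h1 : x ∈ mInterval a b) (h2 : x ∈ mInterval b c)
    (h3 : x ∈ mInterval a c) : x = med hm a b c :=
  (hm a b c).choose_spec.2 x ⟨⟨h1, h2⟩, h3⟩

theorem med_swap (a b c : X) : med hm a b c = med hm b a c :=
  med_eq hm (mi_symm (med_ab hm a b c)) (med_ac hm a b c) (med_bc hm a b c)

theorem med_rot (a b c : X) : med hm a b c = med hm b c a :=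
  med_eq hm (med_bc hm a b c) (mi_symm (med_ac hm a b c)) (mi_symm (med_ab hm a b c))

theorem med_of_mem {a b x : X} (hx : x ∈ mInterval a b) : med hm a b x = x :=
  (med_eq hm hx (mi_right _ _) (mi_right _ _)).symm

/-- The median is a gate. -/
theorem med_gate {a b c z : X} (hz : z ∈ mInterval a b) :
    med hm a b c ∈ mInterval c z := by
  set μ := med hm c z a
  set ν := med hm c z b
  have hμz : μ ∈ mInterval z a := med_bc hm c z a
  have hνz : ν ∈ mInterval z b := med_bc hm c z b
  have hρ := med_ab hm c μ ν
  set ρ := med hm c μ ν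
  have h1 : ρ ∈ mInterval c a := mi_trans (med_ac hm c z a) hρ
  have h2 : ρ ∈ mInterval c b := mi_trans (med_ac hm c z b) (med_ac hm c μ ν)
  have h3 : ρ ∈ mInterval a b := by
    have e1 := mi_def.1 hz
    have e2 := mi_def.1 hμz
    have e3 := mi_def.1 hνz
    have e4 : ρ ∈ mInterval μ ν := med_bc hm c μ ν
    have e4 := mi_def.1 e4
    have t1 := dist_triangle a μ ρ
    have t2 := dist_triangle ρ ν b
    have t3 := dist_triangle μ z ν
    have t4 := dist_triangle a ρ b
    rw [mi_def]
    rw [dist_comm z μ, dist_comm μ a, dist_comm z a] at e2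
    linarith
  have : ρ = med hm a b c := med_eq hm h3 (mi_symm h2) (mi_symm h1)
  rw [← this]
  exact mi_trans (med_ab hm c z a) hρ

theorem gate_lip {c c' p p' : X} (h1 : p ∈ mInterval c p') (h2 : p' ∈ mInterval c' p) :
    dist p p' ≤ dist c c' := by
  rw [mi_def] at *
  have t1 := dist_triangle c c' p'
  have t2 := dist_triangle c' c p
  rw [dist_comm c' c] at t2
  rw [dist_comm p' p] at h2
  linarith

theorem med_lip (a b c c' : X) : dist (med hm a b c) (med hm a b c') ≤ dist c c' :=
  gate_lip (med_gate hm (med_ab hm a b c')) (med_gate hm (med_ab hm a b c))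

theorem gate_mem (hm : IsMedianSpace X) {x y z g : X} (hz : z ∈ mInterval x y) (h1 : g ∈ mInterval z x)
    (h2 : g ∈ mInterval z y) : g = z := by
  have := hm
  rw [mi_def] at *
  have t := dist_triangle x g y
  rw [dist_comm z x, dist_comm g x] at h1
  have : dist z g ≤ 0 := by linarith
  exact (dist_le_zero.1 this).symm

theorem mi_convex (hm : IsMedianSpace X) (a b : X) : MConvex (mInterval a b) := by
  intro x hx y hy z hz
  have := gate_mem hm hz (med_gate hm hx (c := z)) (med_gate hm hy)
  rw [← this]
  exact med_ab hm a b z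

/-- Pasch-type lemma. -/
theorem mi_pasch (hm : IsMedianSpace X) {g u v x t : X} (h1 : x ∈ mInterval g u) (h2 : x ∈ mInterval g v)
    (ht : t ∈ mInterval u v) : x ∈ mInterval g t := by
  set w := med hm u v x
  have a1 : w ∈ mInterval u x := med_ac hm u v x
  have a2 : w ∈ mInterval v x := med_bc hm u v x
  have e : w = med hm u v g :=
    med_eq hm (med_ab hm u v x) (mi_trans (mi_symm h2) a2) (mi_trans (mi_symm h1) a1)
  have a3 : x ∈ mInterval w g := mi_trans' (mi_symm h1) a1
  have a4 : w ∈ mInterval g t := by rw [e]; exact med_gate hm ht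
  exact mi_trans a4 (mi_symm a3)

theorem join_convex (hm : IsMedianSpace X) {H : Set X} (hH : MConvex H) (u : X) :
    MConvex {z | ∃ s ∈ H, z ∈ mInterval u s} := by
  rintro p ⟨s, hs, hp⟩ p' ⟨s', hs', hp'⟩ z hz
  refine ⟨med hm s s' z, hH s hs s' hs' (med_ab hm s s' z), ?_⟩
  set s'' := med hm s s' z
  set μ := med hm u s'' z
  have b1 : μ ∈ mInterval z u := mi_symm (med_ac hm u s'' z)
  have b2 : μ ∈ mInterval z s'' := mi_symm (med_bc hm u s'' z)
  have b3 : μ ∈ mInterval z s := mi_trans (mi_symm (med_ac hm s s' z)) b2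
  have b4 : μ ∈ mInterval z s' := mi_trans (mi_symm (med_bc hm s s' z)) b2
  have : μ = z := gate_mem hm hz (mi_pasch hm b1 b3 hp) (mi_pasch hm b1 b4 hp')
  rw [← this]
  exact med_ab hm u s'' z

theorem sUnion_convex {c : Set (Set X)} (hc : IsChain (· ⊆ ·) c) (h : ∀ s ∈ c, MConvex s) :
    MConvex (⋃₀ c) := by
  rintro a ⟨s, hs, ha⟩ b ⟨t, ht, hb⟩ z hz
  rcases hc.total hs ht with hst | hst
  · exact ⟨t, ht, h t ht a (hst ha) b hb hz⟩
  · exact ⟨s, hs, h s hs a ha b (hst hb) hz⟩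

theorem separate (hm : IsMedianSpace X) {A : Set X} (hA : MConvex A) (hne : A.Nonempty) {x : X} (hx : x ∉ A) :
    ∃ w : Set X, IsHalfspace w ∧ x ∈ w ∧ Disjoint w A := by
  obtain ⟨H, hAH, hmax⟩ := zorn_subset_nonempty {H : Set X | MConvex H ∧ x ∉ H} (by
    intro c hc hch _
    refine ⟨⋃₀ c, ⟨sUnion_convex hch fun s hs => (hc hs).1, ?_⟩,
      fun s hs => Set.subset_sUnion_of_mem hs⟩
    rintro ⟨s, hs, hxs⟩
    exact (hc hs).2 hxs) A ⟨hA, hx⟩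
  have hHc := hmax.prop.1
  have hxH := hmax.prop.2
  obtain ⟨e, he⟩ := hne
  have key : ∀ u, u ∉ H → ∃ s ∈ H, x ∈ mInterval u s := by
    intro u hu
    by_contra hcon
    have := hmax.le_of_ge (y := {z | ∃ s ∈ H, z ∈ mInterval u s})
      ⟨join_convex hm hHc u, hcon⟩ (fun z hz => ⟨z, hz, mi_right _ _⟩)
    exact hu (this ⟨e, hAH he, mi_left _ _⟩)
  refine ⟨Hᶜ, ⟨?_, by rwa [compl_compl]⟩, hxH, ?_⟩
  · intro u hu v hv t ht htH
    obtain ⟨s, hs, hxs⟩ := key u hu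
    obtain ⟨s', hs', hxs'⟩ := key v hv
    set g := med hm s s' x
    have hg : g ∈ H := hHc s hs s' hs' (med_ab hm s s' x)
    have c1 : x ∈ mInterval g u := mi_trans' (mi_symm hxs) (med_ac hm s s' x)
    have c2 : x ∈ mInterval g v := mi_trans' (mi_symm hxs') (med_bc hm s s' x)
    exact hxH (hHc g hg t htH (mi_pasch hm c1 c2 ht))
  · exact Set.disjoint_left.2 fun z hz hzA => hz (hAH hzA)

theorem singleton_convex (b : X) : MConvex ({b} : Set X) := by
  intro x hx y hy z hz
  simp only [Set.mem_singleton_iff] at *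
  subst hx; subst hy
  rw [mi_def, dist_self, dist_comm z] at hz
  have h0 : dist y z ≤ 0 := by linarith
  exact (dist_le_zero.1 h0).symm

theorem closure_convex (hm : IsMedianSpace X) {A : Set X} (hA : MConvex A) : MConvex (closure A) := by
  intro x hx y hy z hz
  rw [Metric.mem_closure_iff] at *
  intro e he
  obtain ⟨x', hx', h1⟩ := hx (e / 2) (by linarith)
  obtain ⟨y', hy', h2⟩ := hy (e / 2) (by linarith)
  refine ⟨med hm x' y' z, hA x' hx' y' hy' (med_ab hm x' y' z), ?_⟩
  have e1 : z = med hm x y z := (med_of_mem hm hz).symm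
  have l1 : dist (med hm x y z) (med hm x' y z) ≤ dist x x' := by
    rw [med_rot hm x y z, med_rot hm x' y z]; exact med_lip hm _ _ _ _
  have l2 : dist (med hm x' y z) (med hm x' y' z) ≤ dist y y' := by
    rw [med_swap hm x' y z, med_swap hm x' y' z, med_rot hm y x' z, med_rot hm y' x' z]
    exact med_lip hm _ _ _ _
  have t := dist_triangle (med hm x y z) (med hm x' y z) (med hm x' y' z)
  rw [← e1] at t l1
  linarith

theorem exists_gate (hm : IsMedianSpace X) [CompleteSpace X] {K : Set X} (hK : MConvex K) (hcl : IsClosed K)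
    (hne : K.Nonempty) (x : X) : ∃ p ∈ K, ∀ z ∈ K, p ∈ mInterval x z := by
  have hlow : ∀ z ∈ K, Metric.infDist x K ≤ dist x z := fun z hz => Metric.infDist_le_dist_of_mem hz
  set D := Metric.infDist x K
  have hseq : ∀ k : ℕ, ∃ z ∈ K, dist x z < D + 1 / ((k : ℝ) + 1) := fun k =>
    (Metric.infDist_lt_iff hne).1 (by have : (0:ℝ) < 1 / ((k:ℝ) + 1) := by positivity
                                      linarith)
  choose s hsK hs using hseq
  have hd : ∀ z ∈ K, ∀ z' ∈ K, dist z z' ≤ (dist x z - D) + (dist x z' - D) := by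
    intro z hz z' hz'
    have m1 := hlow _ (hK z hz z' hz' (med_ab hm z z' x))
    have m2 := mi_def.1 (mi_symm (med_ac hm z z' x))
    have m3 := mi_def.1 (mi_symm (med_bc hm z z' x))
    have m4 := mi_def.1 (med_ab hm z z' x)
    rw [dist_comm z] at m4
    linarith
  have hc : CauchySeq s := by
    rw [Metric.cauchySeq_iff']
    intro e he
    obtain ⟨N, hN⟩ := exists_nat_one_div_lt (show (0:ℝ) < e / 2 by linarith)
    refine ⟨N, fun k hk => ?_⟩
    have h1 := hd _ (hsK k) _ (hsK N)
    have h2 := hs k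
    have h3 := hs N
    have h4 : 1 / ((k : ℝ) + 1) ≤ 1 / ((N : ℝ) + 1) := Nat.one_div_le_one_div hk
    linarith
  obtain ⟨p, hp⟩ := cauchySeq_tendsto_of_complete hc
  have hpK : p ∈ K := hcl.mem_of_tendsto hp (Filter.Eventually.of_forall hsK)
  have hpD : dist x p ≤ D := by
    have t1 : Filter.Tendsto (fun k => dist x (s k)) Filter.atTop (nhds (dist x p)) :=
      tendsto_const_nhds.dist hp
    have t2 : Filter.Tendsto (fun k : ℕ => D + 1 / ((k : ℝ) + 1)) Filter.atTop (nhds (D + 0)) :=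
      tendsto_const_nhds.add tendsto_one_div_add_atTop_nhds_zero_nat
    rw [add_zero] at t2
    exact le_of_tendsto_of_tendsto' t1 t2 fun k => (hs k).le
  refine ⟨p, hpK, fun z hz => ?_⟩
  have m1 := hlow _ (hK p hpK z hz (med_ab hm p z x))
  have m2 := mi_def.1 (mi_symm (med_ac hm p z x))
  have : dist (med hm p z x) p ≤ 0 := by linarith
  have := dist_le_zero.1 this
  have m3 := mi_symm (med_bc hm p z x)
  rwa [this] at m3

/-- An interval joining `h` to its complement meets the hyperplane. -/
theorem interval_meets (hm : IsMedianSpace X) [ConnectedSpace X] {h : Set X} {a t : X} (ha : a ∈ h) (ht : t ∉ h) :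
    ∃ s ∈ mHyperplane h, s ∈ mInterval a t := by
  have hcont : Continuous (fun z => med hm a t z) := by
    refine LipschitzWith.continuous (K := 1) (LipschitzWith.of_dist_le_mul fun z z' => ?_)
    simpa using med_lip hm a t z z'
  have hconn : IsPreconnected (Set.range fun z => med hm a t z) := isPreconnected_range hcont
  by_contra hcon
  push Not at hcon
  have hr : ∀ z ∈ Set.range (fun z => med hm a t z), z ∈ mInterval a t := by
    rintro _ ⟨z, rfl⟩; exact med_ab hm a t z
  have := (isPreconnected_closed_iff.1 hconn) (closure h) (closure hᶜ) isClosed_closure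
    isClosed_closure (fun z _ => by
      by_cases hz : z ∈ h
      · exact Or.inl (subset_closure hz)
      · exact Or.inr (subset_closure hz))
    ⟨a, ⟨a, med_of_mem hm (mi_left a t)⟩, subset_closure ha⟩
    ⟨t, ⟨t, med_of_mem hm (mi_right a t)⟩, subset_closure ht⟩
  obtain ⟨s, hs1, hs2⟩ := this
  exact hcon s hs2 (hr s hs1)

theorem halfspace_subset (hm : IsMedianSpace X) [ConnectedSpace X] {h w : Set X} (hw : IsHalfspace w) {a : X}
    (ha : a ∈ h) (haw : a ∈ w) (hd : ∀ s ∈ mHyperplane h, s ∉ w) : w ⊆ h := by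
  intro t ht
  by_contra hth
  obtain ⟨s, hs, hst⟩ := interval_meets hm ha hth
  exact hd s hs (hw.1 a haw t ht hst)

theorem depth_gt (hm : IsMedianSpace X) [ConnectedSpace X] (hbd : Bornology.IsBounded (Set.univ : Set X))
    {w : Set X} {a : X} (haw : a ∈ w) (hne : wᶜ.Nonempty) {η : ℝ}
    (hη : ∀ z, z ∉ w → η ≤ dist a z) : η ≤ mDepth Set.univ w := by
  obtain ⟨t, ht⟩ := hne
  obtain ⟨s, hs, _⟩ := interval_meets hm haw ht
  have h1 : η ≤ Metric.infDist a (mHyperplane w) := by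
    rw [Metric.le_infDist ⟨s, hs⟩]
    intro y hy
    have : closure wᶜ ⊆ {z | η ≤ dist a z} :=
      closure_minimal (fun z hz => hη z hz) (isClosed_le continuous_const (by fun_prop))
    exact this hy.2
  refine h1.trans (le_csSup ?_ ⟨a, ⟨haw, trivial⟩, rfl⟩)
  obtain ⟨R, hR⟩ := Metric.isBounded_iff.1 hbd
  refine ⟨R, ?_⟩
  rintro _ ⟨z, ⟨hz, _⟩, rfl⟩
  exact (Metric.infDist_le_dist_of_mem hs).trans (hR trivial trivial)

/-- Generic rank argument. -/
theorem rank_generic (hm : IsMedianSpace X) {n : ℕ}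
    (hr : ¬ ∃ h : Fin (n + 1) → Set X, (∀ i, IsHalfspace (h i)) ∧
      ∀ i j, i ≠ j → TransverseSets (h i) (h j))
    (F : Set (Set X)) (a b : X) (hF : ∀ w ∈ F, IsHalfspace w ∧ b ∉ w)
    (hch : ∀ c ⊆ F, IsChain (· ⊆ ·) c → c.Nonempty → ⋃₀ c ∈ F)
    {η : ℝ} (hη : 0 < η)
    (hex : ∀ c ∈ mInterval b a, dist c a ≤ n * η → ∃ w ∈ F, c ∈ w) :
    ∃ w ∈ F, a ∈ w ∧ ∀ z, z ∉ w → η ≤ dist a z := by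
  by_contra hcon
  push Not at hcon
  have step : ∀ c, ∃ w c', (c ∈ mInterval b a ∧ dist c a ≤ n * η) →
      (w ∈ F ∧ c ∈ w ∧ (∀ w' ∈ F, c ∈ w' → w ⊆ w' → w' ⊆ w) ∧ c' ∉ w ∧ c' ∈ mInterval b c ∧
        dist c' c ≤ η) := by
    intro c
    by_cases hc : c ∈ mInterval b a ∧ dist c a ≤ n * η
    swap
    · exact ⟨∅, c, fun h => absurd h hc⟩
    obtain ⟨w₀, hw₀, hcw₀⟩ := hex c hc.1 hc.2
    obtain ⟨w, _, hmax⟩ := zorn_subset_nonempty {w | w ∈ F ∧ c ∈ w} (by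
      intro ch hchs hchain hne
      refine ⟨⋃₀ ch, ⟨hch ch (fun s hs => (hchs hs).1) hchain hne, ?_⟩,
        fun s hs => Set.subset_sUnion_of_mem hs⟩
      obtain ⟨s, hs⟩ := hne
      exact ⟨s, hs, (hchs hs).2⟩) w₀ ⟨hw₀, hcw₀⟩
    have hwF := hmax.prop.1
    have hcw := hmax.prop.2
    have haw : a ∈ w := by
      by_contra haw
      exact (hF w hwF).1.2 b (hF w hwF).2 a haw hc.1 hcw
    obtain ⟨z, hz, hza⟩ := hcon w hwF haw
    refine ⟨w, med hm b c z, fun _ => ⟨hwF, hcw, fun w' h1 h2 h3 => hmax.le_of_ge ⟨h1, h2⟩ h3,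
      (hF w hwF).1.2 b (hF w hwF).2 z hz (med_ac hm b c z), med_ab hm b c z, ?_⟩⟩
    have e : c = med hm b c a := med_eq hm (mi_right _ _) (mi_left _ _) hc.1
    calc dist (med hm b c z) c = dist (med hm b c z) (med hm b c a) := by rw [← e]
      _ ≤ dist z a := med_lip hm b c z a
      _ ≤ η := by rw [dist_comm]; exact hza.le
  choose M N hMN using step
  let c : ℕ → X := fun i => N^[i] a
  have hsucc : ∀ i, c (i + 1) = N (c i) := fun i => Function.iterate_succ_apply' N i a
  have hgood : ∀ i, i ≤ n → c i ∈ mInterval b a ∧ dist (c i) a ≤ i * η := by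
    intro i
    induction i with
    | zero => intro _; exact ⟨mi_right _ _, by simp [c]⟩
    | succ i ih =>
      intro hi
      obtain ⟨h1, h2⟩ := ih (by omega)
      have hin : (i : ℝ) * η ≤ n * η := by
        have : (i : ℝ) ≤ n := by exact_mod_cast (by omega : i ≤ n)
        gcongr
      obtain ⟨-, -, -, -, h3, h4⟩ := hMN (c i) ⟨h1, h2.trans hin⟩
      rw [hsucc]
      refine ⟨mi_trans h1 h3, ?_⟩
      have := dist_triangle (N (c i)) (c i) a
      push_cast
      linarith
  have hgood' : ∀ i, i ≤ n → c i ∈ mInterval b a ∧ dist (c i) a ≤ n * η := by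
    intro i hi
    refine ⟨(hgood i hi).1, (hgood i hi).2.trans ?_⟩
    have : (i : ℝ) ≤ n := by exact_mod_cast hi
    gcongr
  have hmono : ∀ i j, i ≤ j → j ≤ n → c j ∈ mInterval b (c i) := by
    intro i j hij
    induction j, hij using Nat.le_induction with
    | base => intro _; exact mi_right _ _
    | succ j hij ih =>
      intro hj
      obtain ⟨-, -, -, -, h3, -⟩ := hMN (c j) (hgood' j (by omega))
      rw [hsucc]
      exact mi_trans (ih (by omega)) h3
  have haM : ∀ i, i ≤ n → a ∈ M (c i) := by
    intro i hi
    obtain ⟨h1, h2, -⟩ := hMN (c i) (hgood' i hi)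
    by_contra haw
    exact (hF _ h1).1.2 b (hF _ h1).2 a haw (hgood' i hi).1 h2
  have htrans : ∀ i j, i < j → j ≤ n → (M (c i) ∩ (M (c j))ᶜ).Nonempty ∧
      ((M (c i))ᶜ ∩ M (c j)).Nonempty := by
    intro i j hij hj
    obtain ⟨i1, i2, i3, i4, i5, -⟩ := hMN (c i) (hgood' i (by omega))
    obtain ⟨j1, j2, -, -, -, -⟩ := hMN (c j) (hgood' j hj)
    have k1 : c j ∉ M (c i) := by
      have := hmono (i + 1) j hij hj
      rw [hsucc] at this
      exact (hF _ i1).1.2 b (hF _ i1).2 _ i4 this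
    refine ⟨?_, ⟨c j, k1, j2⟩⟩
    by_contra hem
    have hsub : M (c i) ⊆ M (c j) := by
      intro z hz
      by_contra hz'
      exact hem ⟨z, hz, hz'⟩
    exact k1 (i3 _ j1 (hsub i2) hsub j2)
  refine hr ⟨fun i => M (c i), fun i => (hF _ (hMN (c i) (hgood' i (by omega))).1).1, ?_⟩
  intro i j hij
  have hi : (i : ℕ) ≤ n := by omega
  have hj : (j : ℕ) ≤ n := by omega
  have bi := (hF _ (hMN (c i) (hgood' i hi)).1).2
  have bj := (hF _ (hMN (c j) (hgood' j hj)).1).2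
  rcases lt_or_gt_of_ne (fun h => hij (Fin.ext h) : (i : ℕ) ≠ j) with hlt | hlt
  · obtain ⟨t1, t2⟩ := htrans i j hlt hj
    exact ⟨⟨a, haM i hi, haM j hj⟩, t2, t1, ⟨b, bi, bj⟩⟩
  · obtain ⟨t1, t2⟩ := htrans j i hlt hi
    refine ⟨⟨a, haM i hi, haM j hj⟩, ?_, ?_, ⟨b, bi, bj⟩⟩
    · rw [Set.inter_comm]; exact t1
    · rw [Set.inter_comm]; exact t2

theorem halfspace_sUnion {c : Set (Set X)} (hc : IsChain (· ⊆ ·) c)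
    (h : ∀ s ∈ c, IsHalfspace s) : IsHalfspace (⋃₀ c) := by
  refine ⟨sUnion_convex hc fun s hs => (h s hs).1, ?_⟩
  rintro x hx y hy z hz ⟨s, hs, hzs⟩
  exact (h s hs).2 x (fun hxs => hx ⟨s, hs, hxs⟩) y (fun hys => hy ⟨s, hs, hys⟩) hz hzs

theorem halfspace_compl {w : Set X} (h : IsHalfspace w) : IsHalfspace wᶜ :=
  ⟨h.2, by rw [compl_compl]; exact h.1⟩

theorem deep_one (hm : IsMedianSpace X) {n : ℕ}
    (hr : ¬ ∃ h : Fin (n + 1) → Set X, (∀ i, IsHalfspace (h i)) ∧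
      ∀ i j, i ≠ j → TransverseSets (h i) (h j))
    {a b : X} {η : ℝ} (hη : 0 < η) (hab : n * η < dist b a) :
    ∃ w, IsHalfspace w ∧ b ∉ w ∧ a ∈ w ∧ ∀ z, z ∉ w → η ≤ dist a z := by
  obtain ⟨w, ⟨h1, h2⟩, h3⟩ := rank_generic hm hr {w | IsHalfspace w ∧ b ∉ w} a b
    (fun w hw => hw)
    (fun c hc hch _ => ⟨halfspace_sUnion hch fun s hs => (hc hs).1,
      fun ⟨s, hs, hbs⟩ => (hc hs).2 hbs⟩) hη (by
      intro c _ hc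
      have hcb : c ∉ ({b} : Set X) := by
        rintro rfl
        linarith
      obtain ⟨w, hw, hcw, hd⟩ := separate hm (singleton_convex b) ⟨b, rfl⟩ hcb
      exact ⟨w, ⟨hw, fun hb => Set.disjoint_left.1 hd hb rfl⟩, hcw⟩)
  exact ⟨w, h1, h2, h3⟩

theorem deep_two (hm : IsMedianSpace X) {n : ℕ}
    (hr : ¬ ∃ h : Fin (n + 1) → Set X, (∀ i, IsHalfspace (h i)) ∧
      ∀ i j, i ≠ j → TransverseSets (h i) (h j))
    {a b : X} {η δ : ℝ} (hη : 0 < η) (hδ : 0 < δ) (hab : n * η + n * δ < dist b a) :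
    ∃ w, IsHalfspace w ∧ (∀ z ∈ w, δ ≤ dist b z) ∧ a ∈ w ∧ ∀ z, z ∉ w → η ≤ dist a z := by
  obtain ⟨w, ⟨h1, h2⟩, h3⟩ := rank_generic hm hr {w | IsHalfspace w ∧ ∀ z ∈ w, δ ≤ dist b z} a b
    (fun w hw => ⟨hw.1, fun hb => by
      have := hw.2 b hb
      rw [dist_self] at this
      linarith⟩)
    (fun c hc hch _ => ⟨halfspace_sUnion hch fun s hs => (hc hs).1,
      fun z ⟨s, hs, hbs⟩ => (hc hs).2 z hbs⟩) hη (by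
      intro c _ hc
      have hcb : n * δ < dist c b := by
        have := dist_triangle b c a
        rw [dist_comm b c] at this
        linarith
      obtain ⟨w, hw, hcw, hbw, hd⟩ := deep_one hm hr hδ hcb
      exact ⟨wᶜ, ⟨halfspace_compl hw, fun z hz => hd z hz⟩, hcw⟩)
  exact ⟨w, h1, h2, h3⟩

/-- If `y ∈ v`, `y' ∉ v`, implies monotonicity: a criterion for `med o t y ∈ [o, med o t y']`. -/
theorem med_mono (hm : IsMedianSpace X) {o t y y' : X}
    (H : ∀ v, IsHalfspace v → o ∉ v → t ∈ v → y ∈ v → y' ∉ v → False) :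
    med hm o t y ∈ mInterval o (med hm o t y') := by
  by_contra hcon
  obtain ⟨v, hv, hmv, hd⟩ := separate hm (mi_convex hm _ _) ⟨o, mi_left _ _⟩ hcon
  have ho : o ∉ v := fun h => Set.disjoint_left.1 hd h (mi_left _ _)
  have hm' : med hm o t y' ∉ v := fun h => Set.disjoint_left.1 hd h (mi_right _ _)
  have ht : t ∈ v := by
    by_contra ht
    exact hv.2 o ho t ht (med_ab hm o t y) hmv
  have hy : y ∈ v := by
    by_contra hy
    exact hv.2 o ho y hy (med_ac hm o t y) hmv
  refine H v hv ho ht hy fun hy' => hm' (hv.1 t ht y' hy' (med_bc hm o t y'))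

theorem improve (hm : IsMedianSpace X) [CompleteSpace X] [ConnectedSpace X]
    (hbd : Bornology.IsBounded (Set.univ : Set X)) {n : ℕ}
    (hr : ¬ ∃ h : Fin (n + 1) → Set X, (∀ i, IsHalfspace (h i)) ∧
      ∀ i j, i ≠ j → TransverseSets (h i) (h j))
    {h : Set X} {ε η τ : ℝ} (hε : 0 < ε) (hη : ε < η) (hτ : 0 < τ)
    (hno : ¬ ∃ h₁ h₂ : Set X, IsHalfspace h₁ ∧ IsHalfspace h₂ ∧ Disjoint h₁ h₂ ∧
      h₁ ⊆ h ∧ h₂ ⊆ h ∧ ε < mDepth Set.univ h₁ ∧ ε < mDepth Set.univ h₂)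
    {o t o' t' y : X} (ht : t ∈ h) (ho : ∀ s ∈ mHyperplane h, o ∈ mInterval t s)
    (ht' : t' ∈ h) (ho' : ∀ s ∈ mHyperplane h, o' ∈ mInterval t' s)
    (hY : ∀ u, IsHalfspace u → u ⊆ h → y ∈ u → ε < mDepth Set.univ u)
    (hlarge : n * η + n * τ < dist (med hm o t y) t) :
    ∃ y', (∀ u, IsHalfspace u → u ⊆ h → y' ∈ u → ε < mDepth Set.univ u) ∧
      dist o (med hm o t y) + τ ≤ dist o (med hm o t y') ∧
      dist o' (med hm o' t' y) ≤ dist o' (med hm o' t' y') := by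
  obtain ⟨w, hw, hfar, htw, hdeep⟩ := deep_two hm hr (hε.trans hη) hτ hlarge
  have hmw : med hm o t y ∉ w := fun hh => by
    have := hfar _ hh
    rw [dist_self] at this
    linarith
  have hyw : y ∉ w := fun hh => hmw (hw.1 t htw y hh (med_bc hm o t y))
  have how : o ∉ w := fun hh => hmw (hw.1 o hh t htw (med_ab hm o t y))
  have hsub : ∀ {o t : X} (v : Set X), t ∈ h → (∀ s ∈ mHyperplane h, o ∈ mInterval t s) →
      IsHalfspace v → o ∉ v → t ∈ v → v ⊆ h := by
    intro o t v h1 h2 h3 h4 h5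
    exact halfspace_subset hm h3 h1 h5 fun s hs hsv => h4 (h3.1 t h5 s hsv (h2 s hs))
  have hwh : w ⊆ h := hsub w ht ho hw how htw
  have hwdeep : ε < mDepth Set.univ w := hη.trans_le (depth_gt hm hbd htw ⟨y, hyw⟩ hdeep)
  obtain ⟨y', hy', hg⟩ := exists_gate hm (closure_convex hm hw.1) isClosed_closure
    ⟨t, subset_closure htw⟩ y
  have hgate : ∀ u, IsHalfspace u → y ∉ u → y' ∈ u → w ⊆ u := by
    intro u hu h1 h2 z hz
    by_contra hzu
    exact hu.2 y h1 z hzu (hg z (subset_closure hz)) h2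
  refine ⟨y', ?_, ?_, ?_⟩
  · intro u hu huh hyu
    by_cases hyu' : y ∈ u
    · exact hY u hu huh hyu'
    · have hwu := hgate u hu hyu' hyu
      exact hη.trans_le (depth_gt hm hbd (hwu htw) ⟨y, hyu'⟩
        fun z hz => hdeep z fun hzw => hz (hwu hzw))
  · have h1 : med hm o t y ∈ mInterval o (med hm o t y') := by
      refine med_mono hm fun v hv h1 h2 h3 h4 => ?_
      exact hgate vᶜ (halfspace_compl hv) (fun h => h h3) h4 htw h2
    have h2 : med hm o t y' ∈ closure w :=
      closure_convex hm hw.1 t (subset_closure htw) y' hy' (med_bc hm o t y')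
    have h3 : closure w ⊆ {z | τ ≤ dist (med hm o t y) z} :=
      closure_minimal (fun z hz => hfar z hz) (isClosed_le continuous_const (by fun_prop))
    have h4 : τ ≤ dist (med hm o t y) (med hm o t y') := h3 h2
    have := mi_def.1 h1
    linarith
  · have h1 : med hm o' t' y ∈ mInterval o' (med hm o' t' y') := by
      refine med_mono hm fun v hv h1 h2 h3 h4 => ?_
      have hwv := hgate vᶜ (halfspace_compl hv) (fun h => h h3) h4
      have hvh : v ⊆ h := hsub v ht' ho' hv h1 h2
      exact hno ⟨w, v, hw, hv, Set.disjoint_left.2 fun z hz => hwv hz, hwh, hvh, hwdeep,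
        hY v hv hvh h3⟩
    have := mi_def.1 h1
    have := dist_nonneg (x := med hm o' t' y) (y := med hm o' t' y')
    linarith

theorem hyperplane_convex (hm : IsMedianSpace X) {h : Set X} (hh : IsHalfspace h) : MConvex (mHyperplane h) :=
  fun x hx y hy z hz => ⟨closure_convex hm hh.1 x hx.1 y hy.1 hz,
    closure_convex hm hh.2 x hx.2 y hy.2 hz⟩

theorem hull_convex (A : Set X) : MConvex (mConvexHull A) := by
  intro x hx y hy z hz
  rintro K ⟨hK, hAK⟩
  exact hK x (hx K ⟨hK, hAK⟩) y (hy K ⟨hK, hAK⟩) hz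

theorem subset_hull (A : Set X) : A ⊆ mConvexHull A := fun x hx K hK => hK.2 hx

theorem main_bound (hm : IsMedianSpace X) [CompleteSpace X] [ConnectedSpace X]
    (hbd : Bornology.IsBounded (Set.univ : Set X)) {n : ℕ}
    (hr : ¬ ∃ h : Fin (n + 1) → Set X, (∀ i, IsHalfspace (h i)) ∧
      ∀ i j, i ≠ j → TransverseSets (h i) (h j))
    {h : Set X} (hh : IsHalfspace h) (hne : hᶜ.Nonempty) {ε τ : ℝ} (hε : 0 < ε) (hτ : 0 < τ)
    (hno : ¬ ∃ h₁ h₂ : Set X, IsHalfspace h₁ ∧ IsHalfspace h₂ ∧ Disjoint h₁ h₂ ∧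
      h₁ ⊆ h ∧ h₂ ⊆ h ∧ ε < mDepth Set.univ h₁ ∧ ε < mDepth Set.univ h₂)
    {a : X} (ha : a ∈ h)
    (hdeep : mDepth Set.univ h - ε ≤ Metric.infDist a (mHyperplane h))
    {x : X} (hx : x ∈ h) :
    Metric.infDist x (mConvexHull ({a} ∪ mHyperplane h)) ≤ (2 * n + 1) * ε + 4 * n * τ := by
  obtain ⟨y₀, hy₀⟩ := hne
  obtain ⟨s₀, hs₀, _⟩ := interval_meets hm ha hy₀
  obtain ⟨q, hq, hqg⟩ := exists_gate hm (hyperplane_convex hm hh)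
    (isClosed_closure.inter isClosed_closure) ⟨s₀, hs₀⟩ a
  set K := closure (mConvexHull ({a} ∪ mHyperplane h)) with hKdef
  have hKc : MConvex K := closure_convex hm (hull_convex _)
  have haK : a ∈ K := subset_closure (subset_hull _ (Or.inl rfl))
  have hsK : mHyperplane h ⊆ K := fun s hs => subset_closure (subset_hull _ (Or.inr hs))
  obtain ⟨p, hp, hpg⟩ := exists_gate hm hKc isClosed_closure ⟨a, haK⟩ x
  have hpg' : ∀ s ∈ mHyperplane h, p ∈ mInterval x s := fun s hs => hpg s (hsK hs)
  have hD : Metric.infDist x (mConvexHull ({a} ∪ mHyperplane h)) ≤ dist x p := by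
    rw [← Metric.infDist_closure]
    exact Metric.infDist_le_dist_of_mem hp
  have hqa : Metric.infDist a (mHyperplane h) ≤ dist a q := Metric.infDist_le_dist_of_mem hq
  have hqa' : dist a q ≤ Metric.infDist a (mHyperplane h) := by
    rw [Metric.le_infDist ⟨q, hq⟩]
    intro s hs
    have := mi_def.1 (hqg s hs)
    have := dist_nonneg (x := q) (y := s)
    linarith
  set f : X → ℝ := fun y => dist q (med hm q a y) + dist p (med hm p x y) with hf
  set Y : Set X := {y | ∀ u, IsHalfspace u → u ⊆ h → y ∈ u → ε < mDepth Set.univ u} with hYdef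
  have hy₀Y : y₀ ∈ Y := fun u _ hu hyu => absurd (hu hyu) hy₀
  obtain ⟨R, hR⟩ := Metric.isBounded_iff.1 hbd
  have hbdd : BddAbove (f '' Y) := by
    refine ⟨R + R, ?_⟩
    rintro _ ⟨y, _, rfl⟩
    exact add_le_add (hR trivial trivial) (hR trivial trivial)
  obtain ⟨_, ⟨y, hy, rfl⟩, hylt⟩ := exists_lt_of_lt_csSup (s := f '' Y) ⟨_, y₀, hy₀Y, rfl⟩
    (show sSup (f '' Y) - τ < sSup (f '' Y) by linarith)
  have hbest : ∀ y' ∈ Y, f y' < f y + τ := fun y' hy' => by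
    have := le_csSup hbdd ⟨y', hy', rfl⟩
    linarith
  have hn1 : dist (med hm q a y) a ≤ n * (ε + τ) + n * τ := by
    by_contra hcon
    push Not at hcon
    obtain ⟨y', h1, h2, h3⟩ := improve hm hbd hr hε (show ε < ε + τ by linarith) hτ hno ha hqg hx
      hpg' hy hcon
    have := hbest y' h1
    simp only [hf] at this
    linarith
  have hn2 : dist (med hm p x y) x ≤ n * (ε + τ) + n * τ := by
    by_contra hcon
    push Not at hcon
    obtain ⟨y', h1, h2, h3⟩ := improve hm hbd hr hε (show ε < ε + τ by linarith) hτ hno hx hpg' ha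
      hqg hy hcon
    have := hbest y' h1
    simp only [hf] at this
    linarith
  have e1 := mi_def.1 (med_ab hm q a y)
  have e2 := mi_def.1 (med_ab hm p x y)
  rw [dist_comm q a] at e1
  rw [dist_comm p x] at e2
  have hdle : ∀ z ∈ h, Metric.infDist z (mHyperplane h) ≤ mDepth Set.univ h := by
    intro z hz
    refine le_csSup ⟨R, ?_⟩ ⟨z, ⟨hz, trivial⟩, rfl⟩
    rintro _ ⟨z, ⟨hz, _⟩, rfl⟩
    exact (Metric.infDist_le_dist_of_mem hq).trans (hR trivial trivial)
  suffices hfy : f y ≤ mDepth Set.univ h by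
    simp only [hf] at hfy
    nlinarith
  by_cases hyh : y ∈ h
  · refine le_trans ?_ (hdle y hyh)
    rw [Metric.le_infDist ⟨q, hq⟩]
    intro s hs
    obtain ⟨κ, hκ, hκg⟩ := exists_gate hm hKc isClosed_closure ⟨a, haK⟩ y
    have k1 := mi_def.1 (hκg s (hsK hs))
    have k2 : dist p (med hm p x y) ≤ dist y κ := by
      have : p = med hm p x κ := med_eq hm (mi_left _ _) (hpg κ hκ) (mi_left _ _)
      calc dist p (med hm p x y) = dist (med hm p x κ) (med hm p x y) := by rw [← this]
        _ ≤ dist κ y := med_lip hm _ _ _ _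
        _ = dist y κ := dist_comm _ _
    have k3 : dist q (med hm q a y) ≤ dist κ s := by
      have l1 : q = med hm q a s := med_eq hm (mi_left _ _) (hqg s hs) (mi_left _ _)
      have l2 : med hm q a κ = med hm q a y := by
        refine med_eq hm (med_ab hm q a κ) ?_ ?_
        · exact mi_trans (mi_symm (hκg a haK)) (med_bc hm q a κ)
        · exact mi_trans (mi_symm (hκg q (hsK hq))) (med_ac hm q a κ)
      calc dist q (med hm q a y) = dist (med hm q a s) (med hm q a κ) := by rw [← l1, l2]
        _ ≤ dist s κ := med_lip hm _ _ _ _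
        _ = dist κ s := dist_comm _ _
    simp only [hf]
    linarith
  · have z1 : q = med hm q a y := by
      obtain ⟨s, hs, hsy⟩ := interval_meets hm ha hyh
      exact med_eq hm (mi_left _ _) (mi_trans hsy (hqg s hs)) (mi_left _ _)
    have z2 : p = med hm p x y := by
      obtain ⟨s, hs, hsy⟩ := interval_meets hm hx hyh
      exact med_eq hm (mi_left _ _) (mi_trans hsy (hpg' s hs)) (mi_left _ _)
    have z3 : f y = 0 := by
      simp only [hf]
      rw [← z1, ← z2, dist_self, dist_self, add_zero]
    rw [z3]
    exact Metric.infDist_nonneg.trans (hdle a ha)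

end Helpers

/-- In a complete connected bounded median space `C` of rank `n`, if `h` is a halfspace with
nonempty complement and `ε > 0` is such that `h` contains no two disjoint halfspaces of depth
greater than `ε`, then for every `a ∈ h` with `d(a,ĥ) ≥ depth_C(h) − ε`, the convex hull
`Conv({a} ∪ ĥ)` is at Hausdorff distance at most `(n(n+1)+1)ε` from `h`. -/
theorem statement13 (C : Type*) [MetricSpace C] [CompleteSpace C] [ConnectedSpace C]
    (hmed : IsMedianSpace C) (hbd : Bornology.IsBounded (Set.univ : Set C))
    (n : ℕ) (hrank : HasMedianRank C n)
    (h : Set C) (hh : IsHalfspace h) (hne : hᶜ.Nonempty)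
    (ε : ℝ) (hε : 0 < ε)
    (hno : ¬ ∃ h₁ h₂ : Set C, IsHalfspace h₁ ∧ IsHalfspace h₂ ∧ Disjoint h₁ h₂ ∧
      h₁ ⊆ h ∧ h₂ ⊆ h ∧ ε < mDepth Set.univ h₁ ∧ ε < mDepth Set.univ h₂)
    (a : C) (ha : a ∈ h)
    (hdeep : mDepth Set.univ h - ε ≤ Metric.infDist a (mHyperplane h)) :
    Metric.hausdorffDist (mConvexHull ({a} ∪ mHyperplane h)) h ≤
      ((n : ℝ) * (n + 1) + 1) * ε := by
  have hr := hrank.2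
  have hn : 1 ≤ n := by
    by_contra hn
    have h0 : n = 0 := by omega
    subst h0
    exact hr ⟨fun _ => h, fun _ => hh, fun i j hij => absurd (Fin.ext (by omega)) hij⟩
  have hn' : (1 : ℝ) ≤ n := by exact_mod_cast hn
  refine Metric.hausdorffDist_le_of_infDist (by positivity) ?_ ?_
  · intro z hz
    have : z ∈ closure h := hz (closure h) ⟨closure_convex hmed hh.1, by
      rintro s (rfl | hs)
      · exact subset_closure ha
      · exact hs.1⟩
    rw [Metric.infDist_zero_of_mem_closure this]
    positivity
  · intro x hx
    have h1 : Metric.infDist x (mConvexHull ({a} ∪ mHyperplane h)) ≤ (2 * n + 1) * ε := by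
      refine le_of_forall_pos_le_add fun δ hδ => ?_
      have h2 := main_bound hmed hbd hr hh hne hε (show 0 < δ / (4 * n) by positivity) hno ha
        hdeep hx
      have h3 : 4 * (n : ℝ) * (δ / (4 * n)) = δ := by field_simp
      linarith
    refine h1.trans ?_
    have h4 : 2 * (n : ℝ) + 1 ≤ n * (n + 1) + 1 := by nlinarith
    exact mul_le_mul_of_nonneg_right h4 hε.le
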